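/- Let A be a commutative ℚ-algebra and let G be a finite group acting on a finite A-weighted set (X, f) with f G-invariant. Let Y = X/^orb G with its induced weight. Then the weighted cardinality of the orbicycle set C^orb_n(Y) = Y^{ℤ/nℤ}/^orb ℤ/nℤ (rotation action on maps ℤ/nℤ → Y) is |C^orb_n(X/^orb G)|_f = (1/n) · Σ_{d ∣ n} J₂(d) · ( (1/|G|) · Σ_{ḡ ∈ C(G)} |ḡ| · Σ_{h ∈ Z(g)} |X^g ∩ X^h|_{f^d} )^{n/d}, where |X^g ∩ X^h|_{f^d} = Σ_{x ∈ X^g ∩ X^h} f(x)^d. -/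

import Mathlib

/-- The action of the centralizer `Z(g)` on the fixed-point set `Y^g`. -/
instance fixedSubAction {G Y : Type*} [Group G] [MulAction G Y] (g : G) :
    MulAction (Subgroup.centralizer ({g} : Set G)) {y : Y // g • y = y} where
  smul h y := ⟨(h : G) • (y : Y), by
    have hc : g * (h : G) = (h : G) * g :=
      (Subgroup.mem_centralizer_iff.mp h.2) g (Set.mem_singleton g)
    calc g • ((h : G) • (y : Y)) = (g * (h : G)) • (y : Y) := (mul_smul _ _ _).symm
      _ = ((h : G) * g) • (y : Y) := by rw [hc]
      _ = (h : G) • g • (y : Y) := mul_smul _ _ _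
      _ = (h : G) • (y : Y) := by rw [y.2]⟩
  one_smul y := Subtype.ext (one_smul _ _)
  mul_smul h k y := Subtype.ext (mul_smul (h : G) (k : G) (y : Y))

/-- `ℤ/nℤ` (written multiplicatively) acts on maps `ℤ/nℤ → Y` by rotation:
`(s • α) k = α (k - s)`. -/
instance rotAction {n : ℕ} {Y : Type*} : MulAction (Multiplicative (ZMod n)) (ZMod n → Y) where
  smul s α := fun k => α (k - s.toAdd)
  one_smul α := by
    show (fun k => α (k - (1 : Multiplicative (ZMod n)).toAdd)) = α
    ext k; simp
  mul_smul s t α := by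
    show (fun k => α (k - (s * t).toAdd)) = fun k => α (k - s.toAdd - t.toAdd)
    ext k
    rw [toAdd_mul, sub_sub]

/-- The Jordan totient function
`J₂(m) = #{(x,y) ∈ (ℤ/mℤ)² : gcd(x, y, m) = 1}`. -/
noncomputable def jordanTwo (m : ℕ) : ℕ :=
  Nat.card {p : ZMod m × ZMod m // Nat.gcd (Nat.gcd p.1.val p.2.val) m = 1}

open scoped Classical in
/-- Weighted form of Burnside's lemma. -/
theorem sum_fixed_eq_card_nsmul_sum_orbits {A K S : Type*} [AddCommMonoid A] [Group K] [Fintype K]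
    [Fintype S] [MulAction K S] (w : S → A) (hw : ∀ (h : K) (x : S), w (h • x) = w x) :
    ∑ h : K, ∑ x : S, (if h • x = x then w x else 0) =
      Nat.card K • ∑ q : Quotient (MulAction.orbitRel K S), w q.out := by
  have hstab (x : S) : Nat.card {y // y ∈ MulAction.orbit K x} *
      (Finset.univ.filter fun h : K => h • x = x).card = Nat.card K := by
    have h1 := Subgroup.card_mul_index (MulAction.stabilizer K x)
    rw [MulAction.index_stabilizer, mul_comm] at h1
    rw [← h1]
    congr 1
    rw [Nat.card_eq_fintype_card, ← Fintype.card_subtype]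
    exact Fintype.card_congr (Equiv.refl _)
  rw [Finset.sum_comm, Finset.smul_sum,
    ← Finset.sum_fiberwise (s := Finset.univ) (g := fun x : S =>
      (Quotient.mk (MulAction.orbitRel K S) x))]
  refine Finset.sum_congr rfl fun q _ => ?_
  have hmem (x : S) (hx : (Quotient.mk (MulAction.orbitRel K S) x) = q) :
      MulAction.orbit K x = MulAction.orbit K q.out := by
    rw [← hx, MulAction.orbit_eq_iff, ← MulAction.orbitRel_apply]
    exact (MulAction.orbitRel K S).symm (Quotient.mk_out x)
  have hcard : (Finset.univ.filter fun x : S =>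
      (Quotient.mk (MulAction.orbitRel K S) x) = q).card =
      Nat.card {y // y ∈ MulAction.orbit K q.out} := by
    rw [Nat.card_eq_fintype_card, Fintype.card_subtype]
    congr 1
    ext x
    simp only [Finset.mem_filter, Finset.mem_univ, true_and]
    rw [← MulAction.orbitRel_apply]
    constructor
    · rintro rfl
      exact (MulAction.orbitRel K S).symm (Quotient.mk_out x)
    · intro h
      rw [← Quotient.out_eq q]
      exact Quotient.sound h
  rw [← hstab q.out, ← hcard, mul_smul, ← Finset.sum_const]
  refine Finset.sum_congr rfl fun x hx => ?_
  have hx' := hmem x (by simpa using hx)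
  have hpos : 0 < Nat.card {y // y ∈ MulAction.orbit K q.out} := by
    have : Nonempty {y // y ∈ MulAction.orbit K q.out} := ⟨⟨_, MulAction.mem_orbit_self _⟩⟩
    exact Nat.card_pos
  have h2 := hstab x
  rw [hx', ← hstab q.out] at h2
  have hwx : w x = w q.out := by
    obtain ⟨k, hk⟩ := (MulAction.orbit_eq_iff.mp hx')
    rw [← hk]; exact hw _ _
  rw [← Nat.eq_of_mul_eq_mul_left hpos h2, ← Finset.sum_filter, Finset.sum_const, hwx]

theorem card_conjClass_mul_card_centralizer {G : Type*} [Group G] [Finite G] (g : G) :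
    Nat.card (ConjClasses.mk g).carrier * Nat.card (Subgroup.centralizer ({g} : Set G)) =
      Nat.card G := by
  have h1 := Subgroup.card_mul_index (MulAction.stabilizer (ConjAct G) g)
  rw [MulAction.index_stabilizer, ConjAct.orbit_eq_carrier_conjClasses, mul_comm,
    ConjAct.stabilizer_eq_centralizer] at h1
  exact h1

/-- Maps invariant under translation by `H` are counted, with product weight, by maps on `M ⧸ H`. -/
theorem sum_prod_of_translation_invariant {A M Y : Type*} [CommSemiring A]
    [AddCommGroup M] [Fintype M] [DecidableEq M] [Fintype Y] (w : Y → A) (H : AddSubgroup M)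
    [DecidablePred fun β : M → Y => ∀ h ∈ H, ∀ k, β (k + h) = β k] :
    ∑ β : M → Y with (∀ h ∈ H, ∀ k, β (k + h) = β k), ∏ k, w (β k) =
      (∑ y, w y ^ Nat.card H) ^ (Nat.card M / Nat.card H) := by
  classical
  have hidx : Nat.card M / Nat.card H = Fintype.card (M ⧸ H) := by
    rw [← Nat.card_eq_fintype_card, ← AddSubgroup.index, ← AddSubgroup.card_mul_index H,
      Nat.mul_div_cancel_left _ Nat.card_pos]
  rw [hidx, ← Finset.card_univ, ← Finset.prod_const, Finset.prod_univ_sum, Fintype.piFinset_univ]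
  symm
  refine Finset.sum_bij (fun γ _ => fun k : M => γ (k : M ⧸ H)) ?_ ?_ ?_ ?_
  · intro γ _
    simp only [Finset.mem_filter, Finset.mem_univ, true_and]
    intro h hh k
    congr 1
    rw [QuotientAddGroup.eq]
    simpa using hh
  · intro γ _ γ' _ h
    funext q
    induction q using QuotientAddGroup.induction_on with
    | H k => exact congrFun h k
  · intro β hβ
    simp only [Finset.mem_filter, Finset.mem_univ, true_and] at hβ
    refine ⟨fun q => β q.out, Finset.mem_univ _, funext fun k => ?_⟩
    obtain ⟨h, hh⟩ := QuotientAddGroup.mk_out_eq_add H k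
    simp only [hh]
    exact hβ _ h.2 _
  · intro γ _
    rw [← Finset.prod_fiberwise (s := Finset.univ) (g := fun k : M => (k : M ⧸ H))]
    refine Finset.prod_congr rfl fun q _ => ?_
    have : ∀ k ∈ Finset.univ.filter (fun k : M => (k : M ⧸ H) = q),
        w (γ (k : M ⧸ H)) = w (γ q) := by
      intro k hk
      rw [(Finset.mem_filter.mp hk).2]
    rw [Finset.prod_congr rfl this, Finset.prod_const]
    congr 1
    rw [← Fintype.card_subtype, ← Nat.card_eq_fintype_card]
    have h2 := Nat.card_congr (QuotientAddGroup.preimageMkEquivAddSubgroupProdSet H {q})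
    rw [Nat.card_prod, Nat.card_unique (α := ({q} : Set (M ⧸ H))), mul_one] at h2
    exact h2.symm

theorem ZMod.closure_pair_eq_zmultiples_gcd {n : ℕ} [NeZero n] (s t : ZMod n) :
    AddSubgroup.closure {s, t} =
      AddSubgroup.zmultiples ((Nat.gcd (Nat.gcd s.val t.val) n : ℕ) : ZMod n) := by
  set g := Nat.gcd (Nat.gcd s.val t.val) n with hg
  apply le_antisymm
  · rw [AddSubgroup.closure_le]
    have key (a : ZMod n) (ha : g ∣ a.val) :
        a ∈ AddSubgroup.zmultiples ((g : ℕ) : ZMod n) := by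
      obtain ⟨m, hm⟩ := ha
      refine AddSubgroup.mem_zmultiples_iff.mpr ⟨m, ?_⟩
      rw [← ZMod.natCast_zmod_val a, hm]
      push_cast
      rw [zsmul_eq_mul, mul_comm]
      simp
    rintro a (rfl | rfl)
    · exact key _ ((Nat.gcd_dvd_left _ _).trans (Nat.gcd_dvd_left _ _))
    · exact key _ ((Nat.gcd_dvd_left _ _).trans (Nat.gcd_dvd_right _ _))
  · rw [AddSubgroup.zmultiples_le]
    rw [AddSubgroup.mem_closure_pair]
    have h1 := Nat.gcd_eq_gcd_ab (Nat.gcd s.val t.val) n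
    have h2 := Nat.gcd_eq_gcd_ab s.val t.val
    refine ⟨Nat.gcdA s.val t.val * Nat.gcdA (Nat.gcd s.val t.val) n,
      Nat.gcdB s.val t.val * Nat.gcdA (Nat.gcd s.val t.val) n, ?_⟩
    have h3 := congrArg (Int.cast : ℤ → ZMod n) h1
    have h4 := congrArg (Int.cast : ℤ → ZMod n) h2
    push_cast at h3 h4
    rw [ZMod.natCast_self, zero_mul, add_zero, h4] at h3
    rw [hg, h3]
    simp only [zsmul_eq_mul, ZMod.natCast_zmod_val]
    push_cast
    ring

theorem ZMod.card_closure_pair {n : ℕ} [NeZero n] (s t : ZMod n) :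
    Nat.card (AddSubgroup.closure {s, t}) = n / Nat.gcd (Nat.gcd s.val t.val) n := by
  rw [ZMod.closure_pair_eq_zmultiples_gcd, Nat.card_zmultiples,
    ZMod.addOrderOf_coe _ (NeZero.ne n), Nat.gcd_eq_right (Nat.gcd_dvd_right _ _)]

/-- `jordanTwo d` counts the pairs generating the subgroup of order `d` of `ZMod n`. -/
theorem card_pairs_card_closure_eq {n d : ℕ} [NeZero n] (hd : d ∣ n) :
    (Finset.univ.filter fun p : ZMod n × ZMod n =>
      Nat.card (AddSubgroup.closure {p.1, p.2}) = d).card = jordanTwo d := by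
  obtain ⟨e, rfl⟩ := hd
  have hde : d * e ≠ 0 := NeZero.ne _
  have : NeZero d := ⟨left_ne_zero_of_mul hde⟩
  have he : 0 < e := Nat.pos_of_ne_zero (right_ne_zero_of_mul hde)
  have hval (a : ZMod d) : ((a.val * e : ℕ) : ZMod (d * e)).val = a.val * e :=
    ZMod.val_cast_of_lt (Nat.mul_lt_mul_of_pos_right a.val_lt he)
  have hcond (a b : ZMod (d * e)) : Nat.card (AddSubgroup.closure {a, b}) = d ↔
      Nat.gcd (Nat.gcd a.val b.val) (d * e) = e := by
    rw [ZMod.card_closure_pair]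
    obtain ⟨m, hm⟩ := Nat.gcd_dvd_right (Nat.gcd a.val b.val) (d * e)
    set g := Nat.gcd (Nat.gcd a.val b.val) (d * e)
    have hg : 0 < g := Nat.pos_of_ne_zero fun h => hde (by rw [hm, h, zero_mul])
    rw [hm, Nat.mul_div_cancel_left _ hg]
    constructor
    · rintro rfl
      rw [mul_comm m e] at hm
      exact (Nat.eq_of_mul_eq_mul_right (Nat.pos_of_neZero m) hm).symm
    · intro h
      rw [h, mul_comm] at hm
      exact (Nat.eq_of_mul_eq_mul_left he hm).symm
  rw [jordanTwo, Nat.card_eq_fintype_card, Fintype.card_subtype]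
  symm
  refine Finset.card_bij
    (fun p _ => (((p.1.val * e : ℕ) : ZMod (d * e)), ((p.2.val * e : ℕ) : ZMod (d * e)))) ?_ ?_ ?_
  · rintro ⟨a, b⟩ h
    simp only [Finset.mem_filter, Finset.mem_univ, true_and] at h ⊢
    rw [hcond, hval, hval, Nat.gcd_mul_right, Nat.gcd_mul_right, h, one_mul]
  · rintro ⟨a, b⟩ _ ⟨a', b'⟩ _ h
    simp only [Prod.mk.injEq] at h
    have key (a a' : ZMod d)
        (h : ((a.val * e : ℕ) : ZMod (d * e)) = ((a'.val * e : ℕ) : ZMod (d * e))) : a = a' := by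
      have := congrArg ZMod.val h
      rw [hval, hval] at this
      exact ZMod.val_injective d (Nat.eq_of_mul_eq_mul_right he this)
    rw [key _ _ h.1, key _ _ h.2]
  · rintro ⟨a, b⟩ h
    simp only [Finset.mem_filter, Finset.mem_univ, true_and, hcond] at h
    have key (a : ZMod (d * e)) (ha : e ∣ a.val) :
        ∃ a' : ZMod d, ((a'.val * e : ℕ) : ZMod (d * e)) = a := by
      obtain ⟨m, hm⟩ := ha
      have hlt : m < d := by
        have := a.val_lt
        rw [hm, mul_comm d e] at this
        exact lt_of_mul_lt_mul_left this he.le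
      refine ⟨(m : ZMod d), ?_⟩
      rw [ZMod.val_cast_of_lt hlt, mul_comm m e, ← hm, ZMod.natCast_zmod_val]
    have hdvd : e ∣ Nat.gcd a.val b.val := by
      have := Nat.gcd_dvd_left (Nat.gcd a.val b.val) (d * e)
      rwa [h] at this
    obtain ⟨a', ha'⟩ := key a (hdvd.trans (Nat.gcd_dvd_left _ _))
    obtain ⟨b', hb'⟩ := key b (hdvd.trans (Nat.gcd_dvd_right _ _))
    refine ⟨(a', b'), ?_, by rw [ha', hb']⟩
    simp only [Finset.mem_filter, Finset.mem_univ, true_and]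
    rw [← ha', ← hb', hval, hval, Nat.gcd_mul_right, Nat.gcd_mul_right] at h
    exact Nat.eq_of_mul_eq_mul_right he (by rw [h, one_mul])

/-- The weighted cardinality of an orbiquotient as a sum over pairs of commuting elements. -/
theorem sum_orbiquotient {A G X : Type*} [CommRing A] [Algebra ℚ A]
    [Group G] [Fintype G] [Fintype X] [MulAction G X]
    (f : X → A) (hf : ∀ (g : G) (x : X), f (g • x) = f x)
    (repG : ConjClasses G → G) (hrepG : ∀ c, ConjClasses.mk (repG c) = c) :
    ∑ᶠ y : (Σ c : ConjClasses G,
        Quotient (MulAction.orbitRel (Subgroup.centralizer ({repG c} : Set G))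
          {x : X // repG c • x = x})), f (y.2.out : X) =
      (Nat.card G : ℚ)⁻¹ •
          (∑ᶠ c : ConjClasses G, Nat.card (ConjClasses.carrier c) •
            ∑ᶠ h : Subgroup.centralizer ({repG c} : Set G),
              ∑ᶠ x ∈ ({x : X | repG c • x = x} ∩ {x : X | (h : G) • x = x}), f x) := by
  classical
  have hG : (Nat.card G : ℚ) ≠ 0 := by exact_mod_cast Nat.card_pos.ne'
  rw [eq_inv_smul_iff₀ hG, Nat.cast_smul_eq_nsmul, finsum_eq_sum_of_fintype,
    finsum_eq_sum_of_fintype, Fintype.sum_sigma, Finset.smul_sum]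
  refine Finset.sum_congr rfl fun c _ => ?_
  have hc := card_conjClass_mul_card_centralizer (repG c)
  rw [hrepG] at hc
  rw [← hc, mul_smul]
  congr 1
  have := sum_fixed_eq_card_nsmul_sum_orbits (K := Subgroup.centralizer ({repG c} : Set G))
    (fun x : {x : X // repG c • x = x} => f x) (fun h x => hf h x)
  rw [← this, finsum_eq_sum_of_fintype]
  refine Finset.sum_congr rfl fun h _ => ?_
  rw [finsum_mem_def, finsum_eq_sum_of_fintype]
  simp only [Set.indicator_apply, Set.mem_inter_iff, Set.mem_ofPred_eq, ite_and]
  rw [← Finset.sum_filter, Finset.sum_subtype (p := fun x : X => repG c • x = x) _ (by simp)]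
  refine Finset.sum_congr rfl fun x _ => ?_
  simp only [Subtype.ext_iff]
  rfl

theorem rot_fixed_pair_iff {n : ℕ} {Y : Type*} (s t : Multiplicative (ZMod n)) (β : ZMod n → Y) :
    (s • β = β ∧ t • β = β) ↔
      ∀ h ∈ AddSubgroup.closure {s.toAdd, t.toAdd}, ∀ k, β (k + h) = β k := by
  have key (u : Multiplicative (ZMod n)) : u • β = β ↔ ∀ k, β (k + u.toAdd) = β k := by
    constructor
    · intro h k
      have := congrFun h (k + u.toAdd)
      rw [← this]
      exact congrArg β (add_sub_cancel_right _ _)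
    · intro h
      funext k
      rw [← sub_add_cancel k u.toAdd, h]
      exact congrArg (fun j => β (j - u.toAdd)) (sub_add_cancel _ _)
  rw [key, key]
  constructor
  · rintro ⟨hs, ht⟩ h hh
    induction hh using AddSubgroup.closure_induction with
    | mem x hx => rcases hx with rfl | rfl <;> assumption
    | zero => simp
    | add x y _ _ hx hy => intro k; rw [← add_assoc, hy, hx]
    | neg x _ hx => intro k; rw [← hx, neg_add_cancel_right]
  · intro h
    exact ⟨h _ (AddSubgroup.subset_closure (by simp)), h _ (AddSubgroup.subset_closure (by simp))⟩

theorem sum_pairs_eq_sum_jordanTwo {A : Type*} [AddCommMonoid A] {n : ℕ} [NeZero n] (P : ℕ → A) :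
    ∑ p : ZMod n × ZMod n, P (Nat.card (AddSubgroup.closure {p.1, p.2})) =
      ∑ d ∈ n.divisors, jordanTwo d • P d := by
  rw [← Finset.sum_fiberwise_of_maps_to (t := n.divisors)
    (g := fun p : ZMod n × ZMod n => Nat.card (AddSubgroup.closure {p.1, p.2}))]
  · refine Finset.sum_congr rfl fun d hd => ?_
    rw [← card_pairs_card_closure_eq (Nat.dvd_of_mem_divisors hd), ← Finset.sum_const]
    refine Finset.sum_congr rfl fun p hp => ?_
    rw [(Finset.mem_filter.mp hp).2]
  · intro p _
    rw [Nat.mem_divisors]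
    refine ⟨?_, NeZero.ne n⟩
    conv_rhs => rw [← Nat.card_zmod n]
    exact AddSubgroup.card_addSubgroup_dvd_card _

theorem sum_conjClasses_comm {A M : Type*} [AddCommMonoid A] [CommGroup M] [Fintype M]
    (F : M → M → A) (rep : ConjClasses M → M) (hrep : ∀ c, ConjClasses.mk (rep c) = c) :
    ∑ᶠ c : ConjClasses M, Nat.card (ConjClasses.carrier c) •
      ∑ᶠ h : Subgroup.centralizer ({rep c} : Set M), F (rep c) h = ∑ p : M × M, F p.1 p.2 := by
  classical
  have hbij : Function.Bijective rep := by
    refine ⟨fun a b h => by rw [← hrep a, h, hrep b], fun m => ⟨ConjClasses.mk m, ?_⟩⟩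
    exact isConj_iff_eq.mp (ConjClasses.mk_eq_mk_iff_isConj.mp (hrep _))
  rw [Fintype.sum_prod_type, ← hbij.sum_comp, finsum_eq_sum_of_fintype]
  refine Finset.sum_congr rfl fun c _ => ?_
  have htop : Subgroup.centralizer ({rep c} : Set M) = ⊤ := by
    rw [eq_top_iff]
    intro m _
    exact Subgroup.mem_centralizer_iff.mpr fun h _ => mul_comm _ _
  have hcard := card_conjClass_mul_card_centralizer (rep c)
  rw [hrep, htop, Subgroup.card_top] at hcard
  rw [Nat.eq_of_mul_eq_mul_right Nat.card_pos (hcard.trans (one_mul _).symm), one_smul, htop,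
    finsum_eq_sum_of_fintype]
  exact Subgroup.topEquiv.toEquiv.sum_comp (F (rep c))

/-- For a finite group `G` acting on a finite `A`-weighted
set `(X,f)` (`f` invariant, `A` a commutative `ℚ`-algebra), the weighted
cardinality of the orbicycle set `C^orb_n(X/^orb G)` equals
`(1/n) Σ_{d ∣ n} J₂(d) ((1/|G|) Σ_{ḡ} |ḡ| Σ_{h ∈ Z(g)} |X^g ∩ X^h|_{f^d})^{n/d}`. -/
theorem orbicycles_of_orbiquotient
    {A : Type*} [CommRing A] [Algebra ℚ A]
    {G X : Type*} [Group G] [Fintype G] [Fintype X] [MulAction G X]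
    (f : X → A) (hf : ∀ (g : G) (x : X), f (g • x) = f x)
    (n : ℕ) (hn : 0 < n)
    (repG : ConjClasses G → G) (hrepG : ∀ c, ConjClasses.mk (repG c) = c)
    (repn : ConjClasses (Multiplicative (ZMod n)) → Multiplicative (ZMod n))
    (hrepn : ∀ c, ConjClasses.mk (repn c) = c) :
    (let Y : Type _ := Σ c : ConjClasses G,
        Quotient (MulAction.orbitRel (Subgroup.centralizer ({repG c} : Set G))
          {x : X // repG c • x = x});
     let w : Y → A := fun y => f (y.2.out : X);
     ∑ᶠ z : (Σ c' : ConjClasses (Multiplicative (ZMod n)),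
        Quotient (MulAction.orbitRel
          (Subgroup.centralizer ({repn c'} : Set (Multiplicative (ZMod n))))
          {β : ZMod n → Y // repn c' • β = β})),
       ∏ᶠ k : ZMod n, w ((z.2.out : ZMod n → Y) k)) =
    (n : ℚ)⁻¹ •
      ∑ d ∈ n.divisors, jordanTwo d •
        ((Nat.card G : ℚ)⁻¹ •
          (∑ᶠ c : ConjClasses G, Nat.card (ConjClasses.carrier c) •
            ∑ᶠ h : Subgroup.centralizer ({repG c} : Set G),
              ∑ᶠ x ∈ ({x : X | repG c • x = x} ∩ {x : X | (h : G) • x = x}),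
                f x ^ d)) ^ (n / d) := by
  classical
  have : NeZero n := ⟨hn.ne'⟩
  extract_lets Y w
  have : Fintype Y := Fintype.ofFinite _
  have hW (s : Multiplicative (ZMod n)) (β : ZMod n → Y) :
      ∏ᶠ k, w ((s • β) k) = ∏ᶠ k, w (β k) := by
    rw [finprod_eq_prod_of_fintype, finprod_eq_prod_of_fintype]
    exact (Equiv.subRight s.toAdd).prod_comp fun k => w (β k)
  refine (sum_orbiquotient (fun β : ZMod n → Y => ∏ᶠ k, w (β k)) hW repn hrepn).trans ?_
  have hcard : Nat.card (Multiplicative (ZMod n)) = n := Nat.card_zmod n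
  rw [hcard]
  congr 1
  refine (sum_conjClasses_comm (fun s t : Multiplicative (ZMod n) =>
    ∑ᶠ β ∈ ({β : ZMod n → Y | s • β = β} ∩ {β : ZMod n → Y | t • β = β}), ∏ᶠ k, w (β k))
    repn hrepn).trans ?_
  have hpow (d : ℕ) : ∑ y, w y ^ d = (Nat.card G : ℚ)⁻¹ •
      (∑ᶠ c : ConjClasses G, Nat.card (ConjClasses.carrier c) •
        ∑ᶠ h : Subgroup.centralizer ({repG c} : Set G),
          ∑ᶠ x ∈ ({x : X | repG c • x = x} ∩ {x : X | (h : G) • x = x}), f x ^ d) := by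
    rw [← finsum_eq_sum_of_fintype]
    exact sum_orbiquotient (fun x => f x ^ d) (fun g x => by rw [hf]) repG hrepG
  simp only [← hpow]
  rw [← sum_pairs_eq_sum_jordanTwo fun d => (∑ y, w y ^ d) ^ (n / d)]
  refine Fintype.sum_equiv (Multiplicative.toAdd.prodCongr Multiplicative.toAdd) _ _ ?_
  rintro ⟨s, t⟩
  have hprod := sum_prod_of_translation_invariant w (AddSubgroup.closure {s.toAdd, t.toAdd})
  rw [Nat.card_zmod] at hprod
  refine Eq.trans ?_ hprod
  rw [finsum_mem_def, finsum_eq_sum_of_fintype, Finset.sum_filter]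
  refine Finset.sum_congr rfl fun β _ => ?_
  simp only [Set.indicator_apply, Set.mem_inter_iff, Set.mem_ofPred_eq, rot_fixed_pair_iff,
    finprod_eq_prod_of_fintype]
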